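/- arXiv:2102.05172 — 5 statements merged into one kernel-verified Lean document; each statement's English description precedes it below -/
import Mathlib

section
/- Let (D, ~, f) be a finite colored graph, let ε ≥ 0 and 0 ≤ δ < 1, and let m : ∂B → [0,1] be a fixed assignment of values on the blue boundary. If there exists at least one (ε,δ)-DP mechanism p on D with p(d) = m(d) for every d ∈ ∂B, then there exists exactly one (ε,δ)-DP mechanism p* with p*(d) = m(d) for every d ∈ ∂B that dominates every (ε,δ)-DP mechanism q on D satisfying q(d) = m(d) for every d ∈ ∂B. -/
open Real

theorem IsLUB.mul_le_mul_add {ι : Type*} {g h : ι → ℝ} {x y a b c : ℝ}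
    (ha : 0 < a) (hb : 0 ≤ b) (hx : IsLUB (Set.range g) x) (hy : IsLUB (Set.range h) y)
    (H : ∀ i, a * g i ≤ b * h i + c) : a * x ≤ b * y + c := by
  rw [mul_comm, ← le_div_iff₀ ha]
  refine hx.2 ?_
  rintro _ ⟨i, rfl⟩
  rw [le_div_iff₀ ha, mul_comm]
  exact (H i).trans (by gcongr; exact hy.1 ⟨i, rfl⟩)

theorem IsGLB.mul_le_mul_add {ι : Type*} {g h : ι → ℝ} {x y a b c : ℝ}
    (ha : 0 ≤ a) (hb : 0 < b) (hx : IsGLB (Set.range g) x) (hy : IsGLB (Set.range h) y)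
    (H : ∀ i, a * g i ≤ b * h i + c) : a * x ≤ b * y + c := by
  have hle : (a * x - c) / b ≤ y := by
    refine hy.2 ?_
    rintro _ ⟨i, rfl⟩
    rw [div_le_iff₀ hb]
    have := mul_le_mul_of_nonneg_left (hx.1 ⟨i, rfl⟩) ha
    linarith [H i]
  rw [div_le_iff₀ hb] at hle
  linarith

/-- **Theorem 2.** On a finite colored graph, for a fixed assignment `m` of
probabilities on the blue boundary `∂B`, if some `(ε,δ)`-DP mechanism matches `m` on `∂B`,
then there is exactly one `(ε,δ)`-DP mechanism matching `m` on `∂B` that dominates every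
`(ε,δ)`-DP mechanism matching `m` on `∂B`.  Here `p d` is the probability that the
mechanism outputs value 1 on dataset `d`, the blue set is `{d | f d = 1}`, the red set is
`{d | f d = 2}`, `∂B` is the set of blue datasets with a red neighbor, and the probability
of truthful response at `d` is `p d` for blue `d` and `1 - p d` for red `d`. -/
theorem exists_unique_optimal_mechanism_with_boundary_values
    {D : Type*} [Fintype D] (N : D → D → Prop) (hsym : Symmetric N)
    (f : D → ℕ) (hf : ∀ d, f d = 1 ∨ f d = 2)
    (ε δ : ℝ) (hε : 0 ≤ ε) (hδ0 : 0 ≤ δ) (hδ1 : δ < 1)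
    (m : D → ℝ)
    (hm : ∀ d, f d = 1 → (∃ d', N d d' ∧ f d' = 2) → 0 ≤ m d ∧ m d ≤ 1)
    (hex : ∃ p : D → ℝ,
      (∀ d, 0 ≤ p d ∧ p d ≤ 1) ∧
      (∀ d d', N d d' → p d ≤ exp ε * p d' + δ ∧ 1 - p d ≤ exp ε * (1 - p d') + δ) ∧
      (∀ d, f d = 1 → (∃ d', N d d' ∧ f d' = 2) → p d = m d)) :
    ∃! p : D → ℝ,
      ((∀ d, 0 ≤ p d ∧ p d ≤ 1) ∧
       (∀ d d', N d d' → p d ≤ exp ε * p d' + δ ∧ 1 - p d ≤ exp ε * (1 - p d') + δ) ∧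
       (∀ d, f d = 1 → (∃ d', N d d' ∧ f d' = 2) → p d = m d)) ∧
      (∀ q : D → ℝ,
        (∀ d, 0 ≤ q d ∧ q d ≤ 1) →
        (∀ d d', N d d' → q d ≤ exp ε * q d' + δ ∧ 1 - q d ≤ exp ε * (1 - q d') + δ) →
        (∀ d, f d = 1 → (∃ d', N d d' ∧ f d' = 2) → q d = m d) →
        ∀ d, (if f d = 1 then q d else 1 - q d) ≤ (if f d = 1 then p d else 1 - p d)) := by
  obtain ⟨p₀, hp₀⟩ := hex
  let S : Set (D → ℝ) := {p | (∀ d, 0 ≤ p d ∧ p d ≤ 1) ∧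
      (∀ d d', N d d' → p d ≤ exp ε * p d' + δ ∧ 1 - p d ≤ exp ε * (1 - p d') + δ) ∧
      (∀ d, f d = 1 → (∃ d', N d d' ∧ f d' = 2) → p d = m d)}
  have : Nonempty S := ⟨⟨p₀, hp₀⟩⟩
  let P : D → ℝ := fun d ↦ if f d = 1 then ⨆ q : S, q.1 d else ⨅ q : S, q.1 d
  have hE := exp_pos ε
  have hlub (d) (hd : f d = 1) : IsLUB (Set.range fun q : S ↦ q.1 d) (P d) := by
    simp only [P, if_pos hd]
    exact isLUB_ciSup ⟨1, by rintro _ ⟨q, rfl⟩; exact (q.2.1 d).2⟩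
  have hglb (d) (hd : f d = 2) : IsGLB (Set.range fun q : S ↦ q.1 d) (P d) := by
    simp only [P, hd]
    exact isGLB_ciInf ⟨0, by rintro _ ⟨q, rfl⟩; exact (q.2.1 d).1⟩
  have hbd (d) (hd : f d = 1) (hn : ∃ d', N d d' ∧ f d' = 2) : P d = m d := by
    have hc (q : S) : q.1 d = m d := q.2.2.2 d hd hn
    simp [P, hd, hc]
  have hglb_bd (d) (hd : f d = 1) (hn : ∃ d', N d d' ∧ f d' = 2) :
      IsGLB (Set.range fun q : S ↦ q.1 d) (P d) := by
    have hc (q : S) : q.1 d = m d := q.2.2.2 d hd hn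
    simp [hbd d hd hn, hc]
  have hbounds (d) : 0 ≤ P d ∧ P d ≤ 1 := by
    rcases hf d with hd | hd
    · exact ⟨(hp₀.1 d).1.trans ((hlub d hd).1 ⟨⟨p₀, hp₀⟩, rfl⟩),
        (hlub d hd).2 (by rintro _ ⟨q, rfl⟩; exact (q.2.1 d).2)⟩
    · exact ⟨(hglb d hd).2 (by rintro _ ⟨q, rfl⟩; exact (q.2.1 d).1),
        ((hglb d hd).1 ⟨⟨p₀, hp₀⟩, rfl⟩).trans (hp₀.1 d).2⟩
  have hDP (d d') (hN : N d d') :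
      P d ≤ exp ε * P d' + δ ∧ 1 - P d ≤ exp ε * (1 - P d') + δ := by
    have h₁ (q : S) : 1 * q.1 d ≤ exp ε * q.1 d' + δ := by
      linarith [(q.2.2.1 d d' hN).1]
    have h₂ (q : S) : exp ε * q.1 d' ≤ 1 * q.1 d + (exp ε - 1 + δ) := by
      linarith [(q.2.2.1 d d' hN).2]
    have key : (IsLUB (Set.range fun q : S ↦ q.1 d) (P d) ∧
          IsLUB (Set.range fun q : S ↦ q.1 d') (P d')) ∨
        (IsGLB (Set.range fun q : S ↦ q.1 d) (P d) ∧
          IsGLB (Set.range fun q : S ↦ q.1 d') (P d')) := by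
      rcases hf d with hd | hd <;> rcases hf d' with hd' | hd'
      · exact .inl ⟨hlub d hd, hlub d' hd'⟩
      · exact .inr ⟨hglb_bd d hd ⟨d', hN, hd'⟩, hglb d' hd'⟩
      · exact .inr ⟨hglb d hd, hglb_bd d' hd' ⟨d, hsym hN, hd⟩⟩
      · exact .inr ⟨hglb d hd, hglb d' hd'⟩
    rcases key with ⟨h, h'⟩ | ⟨h, h'⟩
    · have := h.mul_le_mul_add one_pos hE.le h' h₁
      have := h'.mul_le_mul_add hE zero_le_one h h₂
      constructor <;> linarith
    · have := h.mul_le_mul_add zero_le_one hE h' h₁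
      have := h'.mul_le_mul_add hE.le one_pos h h₂
      constructor <;> linarith
  have hdom : ∀ q ∈ S, ∀ d,
      (if f d = 1 then q d else 1 - q d) ≤ (if f d = 1 then P d else 1 - P d) := by
    intro q hq d
    rcases hf d with hd | hd
    · simpa only [if_pos hd] using (hlub d hd).1 ⟨⟨q, hq⟩, rfl⟩
    · rw [if_neg (by omega), if_neg (by omega)]
      exact sub_le_sub_left ((hglb d hd).1 ⟨⟨q, hq⟩, rfl⟩) 1
  refine ⟨P, ⟨⟨hbounds, hDP, hbd⟩, fun q h₁ h₂ h₃ ↦ hdom q ⟨h₁, h₂, h₃⟩⟩, ?_⟩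
  rintro q ⟨hq, hqdom⟩
  funext d
  have h₁ := hdom q hq d
  have h₂ := hqdom P hbounds hDP hbd d
  split_ifs at h₁ h₂ <;> linarith
end

section
/- Let (D, ~, f) be a finite connected colored graph with B and R both nonempty, and set n_B = 1 + max_{d ∈ B} dist(d, ∂B) and n_R = 1 + max_{d ∈ R} dist(d, ∂R). Define the boundary morphism g_∂ : D → {1, …, n_B + n_R} by g_∂(d) = n_B − dist(d, ∂B) for d ∈ B and g_∂(d) = n_B + 1 + dist(d, ∂R) for d ∈ R. Then g_∂ is a color-preserving morphism into the (n_B,n_R)-line: g_∂(d) ∈ {1,…,n_B} if and only if d ∈ B, and for all d ~ d' in D, |g_∂(d) − g_∂(d')| ≤ 1. -/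
open Real

/-- Shortest-path distance from a vertex to a set of vertices. -/
noncomputable def distToSet {D : Type*} (G : SimpleGraph D) (d : D) (S : Set D) : ℕ :=
  sInf (G.dist d '' S)

theorem distToSet_le_of_mem {D : Type*} (G : SimpleGraph D) {d s : D} {S : Set D}
    (hs : s ∈ S) : distToSet G d S ≤ G.dist d s :=
  Nat.sInf_le ⟨s, hs, rfl⟩

theorem distToSet_eq_zero_of_mem {D : Type*} (G : SimpleGraph D) {d : D} {S : Set D}
    (hd : d ∈ S) : distToSet G d S = 0 := by
  simpa using distToSet_le_of_mem G (d := d) hd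

theorem distToSet_le_add_one_of_adj {D : Type*} {G : SimpleGraph D} (hconn : G.Connected)
    {d d' : D} (h : G.Adj d d') (S : Set D) : distToSet G d S ≤ distToSet G d' S + 1 := by
  rcases S.eq_empty_or_nonempty with rfl | hS
  · simp [distToSet]
  · obtain ⟨s, hs, hmin⟩ := Nat.sInf_mem (hS.image (G.dist d'))
    calc distToSet G d S ≤ G.dist d s := distToSet_le_of_mem G hs
      _ ≤ G.dist d d' + G.dist d' s := hconn.dist_triangle
      _ = distToSet G d' S + 1 := by
        rw [SimpleGraph.dist_eq_one_iff_adj.mpr h, hmin, distToSet, add_comm]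

/-- The boundary morphism `g∂` of a finite connected colored graph,
`g∂ d = n_B − dist(d,∂B)` for blue `d` and `g∂ d = n_B + 1 + dist(d,∂R)` for red `d`,
is a color-preserving morphism into the `(n_B,n_R)`-line: it takes values in
`{1,…,n_B+n_R}`, it lands in `{1,…,n_B}` exactly on the blue set, and neighboring
vertices are mapped to vertices at distance at most 1 on the line. -/
theorem boundary_morphism_is_color_preserving_morphism
    {D : Type*} [Fintype D] (G : SimpleGraph D) (hconn : G.Connected)
    (f : D → ℕ) (hf : ∀ d, f d = 1 ∨ f d = 2)
    (hBne : ∃ d, f d = 1) (hRne : ∃ d, f d = 2)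
    (bdryB bdryR : Set D)
    (hbdryB : bdryB = {d | f d = 1 ∧ ∃ e, G.Adj d e ∧ f e = 2})
    (hbdryR : bdryR = {d | f d = 2 ∧ ∃ e, G.Adj d e ∧ f e = 1})
    (nB nR : ℕ)
    (hnB : nB = 1 + sSup ((fun d => distToSet G d bdryB) '' {d | f d = 1}))
    (hnR : nR = 1 + sSup ((fun d => distToSet G d bdryR) '' {d | f d = 2}))
    (g : D → ℕ)
    (hg : ∀ d, g d =
      if f d = 1 then nB - distToSet G d bdryB else nB + 1 + distToSet G d bdryR) :
    (∀ d, 1 ≤ g d ∧ g d ≤ nB + nR) ∧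
    (∀ d, (1 ≤ g d ∧ g d ≤ nB) ↔ f d = 1) ∧
    (∀ d d', G.Adj d d' → (g d : ℤ) - g d' ≤ 1 ∧ (g d' : ℤ) - g d ≤ 1) := by
  have hB : ∀ d, f d = 1 → distToSet G d bdryB + 1 ≤ nB := fun d hd => by
    have := le_csSup (Set.toFinite ((fun d => distToSet G d bdryB) '' {d | f d = 1})).bddAbove
      ⟨d, hd, rfl⟩
    simp only at this
    omega
  have hR : ∀ d, f d = 2 → distToSet G d bdryR + 1 ≤ nR := fun d hd => by
    have := le_csSup (Set.toFinite ((fun d => distToSet G d bdryR) '' {d | f d = 2})).bddAbove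
      ⟨d, hd, rfl⟩
    simp only at this
    omega
  have hgB : ∀ d, f d = 1 → g d = nB - distToSet G d bdryB := fun d hd => by simp [hg, hd]
  have hgR : ∀ d, f d = 2 → g d = nB + 1 + distToSet G d bdryR := fun d hd => by simp [hg, hd]
  have hcross : ∀ d d', G.Adj d d' → f d = 1 → f d' = 2 → g d = nB ∧ g d' = nB + 1 := by
    intro d d' h hd hd'
    have h₁ : d ∈ bdryB := hbdryB ▸ ⟨hd, d', h, hd'⟩
    have h₂ : d' ∈ bdryR := hbdryR ▸ ⟨hd', d, h.symm, hd⟩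
    simp [hgB d hd, hgR d' hd', distToSet_eq_zero_of_mem G h₁, distToSet_eq_zero_of_mem G h₂]
  refine ⟨fun d => ?_, fun d => ?_, fun d d' h => ?_⟩
  · rcases hf d with hd | hd
    · have := hB d hd
      have := hgB d hd
      omega
    · have := hR d hd
      have := hgR d hd
      omega
  · rcases hf d with hd | hd
    · have := hB d hd
      have := hgB d hd
      omega
    · have := hgR d hd
      omega
  · rcases hf d with hd | hd <;> rcases hf d' with hd' | hd'
    · have := hB d hd
      have := hB d' hd'
      have := hgB d hd
      have := hgB d' hd'
      have := distToSet_le_add_one_of_adj hconn h bdryB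
      have := distToSet_le_add_one_of_adj hconn h.symm bdryB
      omega
    · have := hcross d d' h hd hd'
      omega
    · have := hcross d' d h.symm hd' hd
      omega
    · have := hgR d hd
      have := hgR d' hd'
      have := distToSet_le_add_one_of_adj hconn h bdryR
      have := distToSet_le_add_one_of_adj hconn h.symm bdryR
      omega
end

section
/- Let (D, ~, f) be a finite connected colored graph with B and R both nonempty, let ε > 0, 0 ≤ δ < 1, and let p be any boundary homogeneous (ε,δ)-DP mechanism on D whose common red-probability on ∂B is R with R ≤ 1/2. Then for every d ∈ B, with Δ = dist(d, ∂B): 1 − p(d) ≥ R/e^{εΔ} − δ(e^{εΔ} − 1)/(e^{εΔ}(e^ε − 1)). -/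
open Real

/-- Group privacy: an approximate-Lipschitz bound on edges telescopes along walks. -/
theorem SimpleGraph.Walk.le_exp_mul_add {D : Type*} {G : SimpleGraph D} {ε δ : ℝ} (hε : 0 < ε)
    {q : D → ℝ} (hq : ∀ d d', G.Adj d d' → q d ≤ exp ε * q d' + δ) {d e : D} (w : G.Walk d e) :
    q e ≤ exp (ε * w.length) * q d + δ * (exp (ε * w.length) - 1) / (exp ε - 1) := by
  have hpos : 0 < exp ε - 1 := sub_pos.mpr (one_lt_exp_iff.mpr hε)
  induction w with
  | nil => simp
  | @cons u v _ h w ih =>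
    have hstep := mul_le_mul_of_nonneg_left (hq v u h.symm) (exp_pos (ε * w.length)).le
    rw [SimpleGraph.Walk.length_cons, Nat.cast_succ, mul_add, mul_one, exp_add]
    refine (ih.trans (add_le_add_left hstep _)).trans_eq ?_
    field_simp
    ring

/-- In a connected graph, a set that is neither empty nor everything has a vertex adjacent to its
complement. -/
theorem SimpleGraph.Connected.exists_adj_mem_notMem {D : Type*} {G : SimpleGraph D}
    (hG : G.Connected) {S : Set D} {u v : D} (hu : u ∈ S) (hv : v ∉ S) :
    ∃ a b, G.Adj a b ∧ a ∈ S ∧ b ∉ S := by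
  obtain ⟨w⟩ := hG.preconnected u v
  obtain ⟨a, -, ha, hb⟩ := w.exists_boundary_dart S hu hv
  exact ⟨_, _, a.adj, ha, hb⟩

/-- The distance to a nonempty set is the length of some walk into that set. -/
theorem SimpleGraph.Connected.exists_walk_length_eq_distToSet {D : Type*} {G : SimpleGraph D}
    (hG : G.Connected) (d : D) {S : Set D} (hS : S.Nonempty) :
    ∃ e ∈ S, ∃ w : G.Walk d e, w.length = distToSet G d S := by
  obtain ⟨e, he, hdist⟩ := Nat.sInf_mem (hS.image (G.dist d))
  obtain ⟨w, hw⟩ := hG.exists_walk_length_eq_dist d e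
  exact ⟨e, he, w, hw.trans hdist⟩

/-- **Corollary 1, lower-bound form.** If a boundary homogeneous
`(ε,δ)`-DP mechanism `p` on a finite connected colored graph has common red-probability
`R ≤ 1/2` on the blue boundary `∂B`, then for every blue dataset `d` at distance `Δ`
from `∂B`: `1 − p(d) ≥ R/e^{εΔ} − δ(e^{εΔ} − 1)/(e^{εΔ}(e^ε − 1))`. -/
theorem boundary_homogeneous_half_lower_bound
    {D : Type*} [Fintype D] (G : SimpleGraph D) (hconn : G.Connected)
    (f : D → ℕ) (hf : ∀ d, f d = 1 ∨ f d = 2)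
    (hBne : ∃ d, f d = 1) (hRne : ∃ d, f d = 2)
    (bdryB : Set D)
    (hbdryB : bdryB = {d | f d = 1 ∧ ∃ e, G.Adj d e ∧ f e = 2})
    (ε δ : ℝ) (hε : 0 < ε) (hδ0 : 0 ≤ δ) (hδ1 : δ < 1)
    (R : ℝ) (hRhalf : R ≤ 1 / 2)
    (p : D → ℝ)
    (hrange : ∀ d, 0 ≤ p d ∧ p d ≤ 1)
    (hDP : ∀ d d', G.Adj d d' →
      p d ≤ exp ε * p d' + δ ∧ 1 - p d ≤ exp ε * (1 - p d') + δ)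
    (hbh : ∀ d ∈ bdryB, 1 - p d = R) :
    ∀ d, f d = 1 →
      1 - p d ≥
        R / exp (ε * (distToSet G d bdryB : ℝ)) -
          δ * (exp (ε * (distToSet G d bdryB : ℝ)) - 1) /
            (exp (ε * (distToSet G d bdryB : ℝ)) * (exp ε - 1)) := by
  intro d hd
  obtain ⟨r, hr⟩ := hRne
  obtain ⟨a, b, hab, ha, hb⟩ :=
    hconn.exists_adj_mem_notMem (S := {x | f x = 1}) hd (show ¬ f r = 1 by omega)
  have hne : bdryB.Nonempty := ⟨a, hbdryB ▸ ⟨ha, b, hab, (hf b).resolve_left hb⟩⟩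
  obtain ⟨e, he, w, hw⟩ := hconn.exists_walk_length_eq_distToSet d hne
  have key := w.le_exp_mul_add hε (q := fun x => 1 - p x) fun x y h => (hDP x y h).2
  simp only [hbh e he, hw] at key
  have hpos : 0 < exp ε - 1 := sub_pos.mpr (one_lt_exp_iff.mpr hε)
  rw [ge_iff_le, mul_comm (exp _) (exp ε - 1), ← div_div, ← sub_div, div_le_iff₀ (exp_pos _)]
  linarith
end

section
/- Let ε ≥ 0 and δ ≥ 0, and let R' ∈ ℝ satisfy e^ε·R' + R' − e^ε ≤ δ. Define R = (R' − δ)/e^ε. Then e^ε·R + R − e^ε ≤ δ. -/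
open Real

/-- Absorption of the switching condition: if
`e^ε·R' + R' − e^ε ≤ δ` and `R = (R' − δ)/e^ε`, then `e^ε·R + R − e^ε ≤ δ`. -/
theorem switching_condition_absorbs (ε δ R' : ℝ) (hε : 0 ≤ ε) (hδ : 0 ≤ δ)
    (h : exp ε * R' + R' - exp ε ≤ δ) :
    exp ε * ((R' - δ) / exp ε) + (R' - δ) / exp ε - exp ε ≤ δ := by
  have hE : 1 ≤ exp ε := one_le_exp hε
  have hpos : 0 < exp ε := exp_pos ε
  have hR : exp ε * ((R' - δ) / exp ε) = R' - δ := mul_div_cancel₀ _ hpos.ne'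
  have hsum : exp ε * ((R' - δ) / exp ε) + (R' - δ) / exp ε ≤ 1 - δ := by
    refine le_of_mul_le_mul_left ?_ hpos
    rw [mul_add, hR]
    linarith
  linarith
end

section
/- Let ε > 0, 0 ≤ δ < 1, and R ∈ [0,1] with (1 − R)(e^{3ε} − e^ε) + δ(e^{2ε} + e^ε) > 0. Then for every real i ≥ 0: 1 − e^{iε}(1 − R) − δ(e^{iε} − 1)/(e^ε − 1) ≤ (e^{2ε} + δe^ε + 2δ + e^ε − 1)/(e^{2ε} + e^ε) if and only if i ≥ (1/ε)·log( (e^ε + 2δ − 1) / ((1 − R)(e^{3ε} − e^ε) + δ(e^{2ε} + e^ε)) ). -/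
open Real

/-- Characterization of the transition index: the value of the initial
recurrence drops to (or below) the switching threshold exactly when
`i ≥ (1/ε)·log((e^ε + 2δ − 1)/((1 − R)(e^{3ε} − e^ε) + δ(e^{2ε} + e^ε)))`. -/
theorem transition_index_characterization (ε δ R : ℝ)
    (hε : 0 < ε) (hδ0 : 0 ≤ δ) (hδ1 : δ < 1) (hR0 : 0 ≤ R) (hR1 : R ≤ 1)
    (hpos : 0 < (1 - R) * (exp (3 * ε) - exp ε) + δ * (exp (2 * ε) + exp ε)) :
    ∀ i : ℝ, 0 ≤ i →
      (1 - exp (i * ε) * (1 - R) - δ * (exp (i * ε) - 1) / (exp ε - 1) ≤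
          (exp (2 * ε) + δ * exp ε + 2 * δ + exp ε - 1) / (exp (2 * ε) + exp ε) ↔
        i ≥ ε⁻¹ * Real.log ((exp ε + 2 * δ - 1) /
          ((1 - R) * (exp (3 * ε) - exp ε) + δ * (exp (2 * ε) + exp ε)))) := by
  intro i _
  have ha : 1 < exp ε := one_lt_exp_iff.mpr hε
  have h2 : exp (2 * ε) = exp ε ^ 2 := by
    rw [← exp_nat_mul]; norm_num
  have h3 : exp (3 * ε) = exp ε ^ 3 := by
    rw [← exp_nat_mul]; norm_num
  have hnum : 0 < exp ε + 2 * δ - 1 := by linarith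
  have hlog : i ≥ ε⁻¹ * Real.log ((exp ε + 2 * δ - 1) /
        ((1 - R) * (exp (3 * ε) - exp ε) + δ * (exp (2 * ε) + exp ε))) ↔
      exp ε + 2 * δ - 1 ≤
        exp (i * ε) * ((1 - R) * (exp (3 * ε) - exp ε) + δ * (exp (2 * ε) + exp ε)) := by
    rw [ge_iff_le, inv_mul_le_iff₀ hε, mul_comm ε i,
      log_le_iff_le_exp (div_pos hnum hpos), div_le_iff₀ hpos]
  rw [hlog, h2, h3]
  generalize exp (i * ε) = x
  generalize exp ε = a at ha
  have ha1 : 0 < a - 1 := by linarith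
  have hden : 0 < a ^ 2 + a := by positivity
  have hdiff : (a ^ 2 + δ * a + 2 * δ + a - 1) / (a ^ 2 + a) -
        (1 - x * (1 - R) - δ * (x - 1) / (a - 1)) =
      (x * ((1 - R) * (a ^ 3 - a) + δ * (a ^ 2 + a)) - (a + 2 * δ - 1)) /
        ((a ^ 2 + a) * (a - 1)) := by
    rw [eq_div_iff (by positivity)]
    field_simp
    ring
  rw [← sub_nonneg, hdiff, le_div_iff₀ (by positivity), zero_mul, sub_nonneg]
end
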